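/- arXiv:2404.11174 — 6 statements merged into one kernel-verified Lean document; each statement's English description precedes it below -/
import Mathlib

section
/- Let u(x) = (−x)^{2/3} and F(x) = (4/3)(1 − (−x)^{1/3}) for x ≤ 0. Then for all real numbers a < b ≤ 0, setting Du = (u(b) − u(a))/(b − a) and DF = (F(b) − F(a))/(b − a), one has DF > 0, Du < 0, (Du)² ≤ DF, and 2(Du)² ≥ (3/2)·DF. Consequently, with q = √(DF − (Du)²), both Du + q < 0 and Du − q < 0. -/
/-- Every nonnegative real `y` has a nonnegative cube root `s`, through which `y`, `y ^ (1/3)` and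
`y ^ (2/3)` are powers of `s`. -/
theorem exists_cube_root_rpow {y : ℝ} (hy : 0 ≤ y) :
    ∃ s : ℝ, 0 ≤ s ∧ s ^ 3 = y ∧ y ^ ((1 : ℝ) / 3) = s ∧ y ^ ((2 : ℝ) / 3) = s ^ 2 := by
  refine ⟨y ^ ((1 : ℝ) / 3), Real.rpow_nonneg hy _, ?_, rfl, ?_⟩
  · rw [← Real.rpow_mul_natCast hy]
    norm_num
  · rw [← Real.rpow_mul_natCast hy]
    norm_num

/-- Cusp example computation: for `u(x) = (−x)^{2/3}`, `F(x) = (4/3)(1 − (−x)^{1/3})`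
and any `a < b ≤ 0`, the difference quotients `Du`, `DF` satisfy `DF > 0`, `Du < 0`,
`(Du)² ≤ DF`, `2(Du)² ≥ (3/2)DF`, and with `q = √(DF − (Du)²)` both `Du + q < 0`
and `Du − q < 0`. -/
theorem stmt_3 (a b : ℝ) (hab : a < b) (hb : b ≤ 0)
    (u F : ℝ → ℝ)
    (hu : ∀ x : ℝ, x ≤ 0 → u x = (-x) ^ ((2 : ℝ) / 3))
    (hF : ∀ x : ℝ, x ≤ 0 → F x = (4 / 3) * (1 - (-x) ^ ((1 : ℝ) / 3)))
    (Du DF q : ℝ)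
    (hDu : Du = (u b - u a) / (b - a))
    (hDF : DF = (F b - F a) / (b - a))
    (hq : q = Real.sqrt (DF - Du ^ 2)) :
    0 < DF ∧ Du < 0 ∧ Du ^ 2 ≤ DF ∧ (3 / 2) * DF ≤ 2 * Du ^ 2 ∧
      Du + q < 0 ∧ Du - q < 0 := by
  obtain ⟨s, hs, hsa, hs1, hs2⟩ := exists_cube_root_rpow (y := -a) (by linarith)
  obtain ⟨t, ht, htb, ht1, ht2⟩ := exists_cube_root_rpow (y := -b) (by linarith)
  have hts : t < s := lt_of_pow_lt_pow_left₀ 3 hs (by linarith)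
  have hst : 0 < s - t := sub_pos.mpr hts
  have hN : 0 < s ^ 2 + s * t + t ^ 2 := by nlinarith [mul_nonneg hs ht]
  have hba : b - a = (s - t) * (s ^ 2 + s * t + t ^ 2) := by linear_combination htb - hsa
  have hDu' : Du = -(s + t) / (s ^ 2 + s * t + t ^ 2) := by
    rw [hDu, hu a (by linarith), hu b hb, hs2, ht2, hba]
    field_simp
    ring
  have hDF' : DF = (4 / 3) / (s ^ 2 + s * t + t ^ 2) := by
    rw [hDF, hF a (by linarith), hF b hb, hs1, ht1, hba]
    field_simp
    ring
  have hDF_pos : 0 < DF := by rw [hDF']; positivity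
  have hDu_neg : Du < 0 := by
    rw [hDu']
    exact div_neg_of_neg_of_pos (by linarith) hN
  have h_upper : Du ^ 2 ≤ DF := by
    rw [hDu', hDF', div_pow, div_le_div_iff₀ (by positivity) hN]
    nlinarith [mul_nonneg hN.le (sq_nonneg (s - t))]
  have h_lower : (3 / 2) * DF ≤ 2 * Du ^ 2 := by
    have h : DF ≤ 4 / 3 * Du ^ 2 := by
      rw [hDu', hDF', div_pow, ← mul_div_assoc, div_le_div_iff₀ hN (by positivity)]
      nlinarith [mul_nonneg hN.le (mul_nonneg hs ht)]
    linarith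
  have hq_nonneg : 0 ≤ q := hq ▸ Real.sqrt_nonneg _
  have hq_lt : q < -Du := by
    rw [hq, Real.sqrt_lt' (by linarith)]
    linarith [neg_sq Du]
  exact ⟨hDF_pos, hDu_neg, h_upper, h_lower, by linarith, by linarith⟩
end

section
/- With u_Δx defined as in the context (for any choice of signs s_j), one has sup over x ∈ ℝ of |u(x) − u_Δx(x)| at most (1 + √2)·√E·√Δx. -/
open MeasureTheory Set

/-- Cauchy–Schwarz on an interval; if `f` is not integrable there, its integral is `0`. -/
lemma sq_intervalIntegral_le {f : ℝ → ℝ} {a b : ℝ} (hab : a < b)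
    (hf : IntervalIntegrable (fun z => f z ^ 2) volume a b) :
    (∫ z in a..b, f z) ^ 2 ≤ (b - a) * ∫ z in a..b, f z ^ 2 := by
  have hL : 0 < b - a := sub_pos.2 hab
  by_cases hi : IntervalIntegrable f volume a b
  · set D := ∫ z in a..b, f z with hD
    set c := D / (b - a) with hc
    have h0 : 0 ≤ ∫ z in a..b, (f z - c) ^ 2 :=
      intervalIntegral.integral_nonneg hab.le fun z _ => sq_nonneg _
    have h1 : ∫ z in a..b, (f z - c) ^ 2
        = (∫ z in a..b, f z ^ 2) - 2 * c * D + (b - a) * c ^ 2 := by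
      have : ∀ z, (f z - c) ^ 2 = f z ^ 2 - 2 * c * f z + c ^ 2 := fun z => by ring
      simp_rw [this]
      rw [intervalIntegral.integral_add (hf.sub (hi.const_mul _)) intervalIntegrable_const,
        intervalIntegral.integral_sub hf (hi.const_mul _),
        intervalIntegral.integral_const_mul, intervalIntegral.integral_const, smul_eq_mul]
    have h2 : D = c * (b - a) := by rw [hc]; field_simp
    rw [h1] at h0
    have h3 := mul_nonneg hL.le h0
    rw [h2] at h3 ⊢
    nlinarith
  · rw [intervalIntegral.integral_undef hi]
    have := intervalIntegral.integral_nonneg (μ := volume) hab.le fun z _ => sq_nonneg (f z)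
    nlinarith [mul_nonneg hL.le this]

/-- A difference bounded by `√(M h)` and a slope bounded by `√(M / h)` over a step of length at
most `h` combine to an error of at most `2 √M √h`. -/
lemma abs_sub_slope_mul_le {M h d m t : ℝ} (hh : 0 < h) (hd : d ^ 2 ≤ h * M)
    (hm : h * m ^ 2 ≤ M) (ht : |t| ≤ h) :
    |d - m * t| ≤ (1 + Real.sqrt 2) * Real.sqrt M * Real.sqrt h := by
  have hM : 0 ≤ M := le_trans (by positivity) hm
  have h1 : |d| ≤ Real.sqrt M * Real.sqrt h := by
    rw [← Real.sqrt_mul hM]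
    exact Real.abs_le_sqrt (by linarith)
  have h2 : |m * t| ≤ Real.sqrt M * Real.sqrt h := by
    rw [← Real.sqrt_mul hM]
    apply Real.abs_le_sqrt
    have : t ^ 2 ≤ h ^ 2 := sq_le_sq' (by linarith [neg_abs_le t]) ((le_abs_self t).trans ht)
    calc (m * t) ^ 2 = m ^ 2 * t ^ 2 := by ring
      _ ≤ m ^ 2 * h ^ 2 := by gcongr
      _ = h * m ^ 2 * h := by ring
      _ ≤ M * h := by gcongr
  have h3 : (1 : ℝ) ≤ Real.sqrt 2 := Real.one_le_sqrt.2 one_le_two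
  have h4 := abs_sub d (m * t)
  nlinarith [mul_nonneg (Real.sqrt_nonneg M) (Real.sqrt_nonneg h)]

/-- L∞ projection estimate: `‖u − u_Δx‖_∞ ≤ (1 + √2)·√E·√Δx` for the piecewise
linear projection of `u` (for any choice of signs `s_j`). -/
theorem stmt_4
    (Δx : ℝ) (hΔx : 0 < Δx)
    (u u' : ℝ → ℝ)
    (hu'int : Integrable (fun z => u' z ^ 2) volume)
    (hftc : ∀ a b : ℝ, a < b → u b - u a = ∫ z in a..b, u' z)
    (E : ℝ) (hE : E = ∫ z, u' z ^ 2)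
    (F : ℝ → ℝ) (hF : ∀ x : ℝ, F x = ∫ z in Iio x, u' z ^ 2)
    (Du DF q : ℤ → ℝ)
    (hDu : ∀ j : ℤ, Du j =
      (u ((2 * (j : ℝ) + 2) * Δx) - u ((2 * (j : ℝ)) * Δx)) / (2 * Δx))
    (hDF : ∀ j : ℤ, DF j =
      (F ((2 * (j : ℝ) + 2) * Δx) - F ((2 * (j : ℝ)) * Δx)) / (2 * Δx))
    (hq : ∀ j : ℤ, q j = Real.sqrt (DF j - Du j ^ 2))
    (s : ℤ → ℝ) (hs : ∀ j : ℤ, s j = 1 ∨ s j = -1)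
    (uΔ : ℝ → ℝ)
    (h1 : ∀ j : ℤ, ∀ x : ℝ, (2 * (j : ℝ)) * Δx < x → x ≤ (2 * (j : ℝ) + 1) * Δx →
      uΔ x = u ((2 * (j : ℝ)) * Δx) + (Du j + s j * q j) * (x - (2 * (j : ℝ)) * Δx))
    (h2 : ∀ j : ℤ, ∀ x : ℝ, (2 * (j : ℝ) + 1) * Δx < x → x ≤ (2 * (j : ℝ) + 2) * Δx →
      uΔ x = u ((2 * (j : ℝ) + 2) * Δx)
        + (Du j - s j * q j) * (x - (2 * (j : ℝ) + 2) * Δx)) :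
    ∀ x : ℝ, |u x - uΔ x| ≤ (1 + Real.sqrt 2) * Real.sqrt E * Real.sqrt Δx := by
  have hinc : ∀ a b : ℝ, F b - F a = ∫ z in a..b, u' z ^ 2 := fun a b => by
    rw [hF, hF, ← integral_Iic_eq_integral_Iio, ← integral_Iic_eq_integral_Iio,
      intervalIntegral.integral_Iic_sub_Iic hu'int.integrableOn hu'int.integrableOn]
  have hFE : ∀ a b : ℝ, F b - F a ≤ E := fun a b => by
    have hb : F b ≤ E := by
      rw [hF, hE]
      exact setIntegral_le_integral hu'int (ae_of_all _ fun z => sq_nonneg _)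
    have ha : 0 ≤ F a := by
      rw [hF]
      exact integral_nonneg fun z => sq_nonneg _
    linarith
  have hCS : ∀ a b : ℝ, a < b → (u b - u a) ^ 2 ≤ (b - a) * (F b - F a) := fun a b hab => by
    rw [hftc a b hab, hinc]
    exact sq_intervalIntegral_le hab hu'int.intervalIntegrable
  have hd : ∀ a b : ℝ, a < b → b - a ≤ Δx → (u b - u a) ^ 2 ≤ Δx * E := fun a b hab hle => by
    have hE0 : 0 ≤ E := hE ▸ integral_nonneg fun z => sq_nonneg _
    calc (u b - u a) ^ 2 ≤ (b - a) * (F b - F a) := hCS a b hab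
      _ ≤ (b - a) * E := mul_le_mul_of_nonneg_left (hFE a b) (sub_pos.2 hab).le
      _ ≤ Δx * E := mul_le_mul_of_nonneg_right hle hE0
  have hslope : ∀ j : ℤ, Δx * (Du j + s j * q j) ^ 2 ≤ E ∧ Δx * (Du j - s j * q j) ^ 2 ≤ E := by
    intro j
    have hc := hCS (2 * (j : ℝ) * Δx) ((2 * (j : ℝ) + 2) * Δx) (by nlinarith)
    have hle := hFE (2 * (j : ℝ) * Δx) ((2 * (j : ℝ) + 2) * Δx)
    have e1 : u ((2 * (j : ℝ) + 2) * Δx) - u (2 * (j : ℝ) * Δx) = 2 * Δx * Du j := by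
      rw [hDu]; field_simp
    have e2 : F ((2 * (j : ℝ) + 2) * Δx) - F (2 * (j : ℝ) * Δx) = 2 * Δx * DF j := by
      rw [hDF]; field_simp
    rw [e1, e2] at hc
    rw [e2] at hle
    have hDle : Du j ^ 2 ≤ DF j := by
      have hp : 0 < (2 * Δx) ^ 2 := by positivity
      refine le_of_mul_le_mul_left ?_ hp
      linarith
    have hq2 : q j ^ 2 = DF j - Du j ^ 2 := by
      rw [hq, Real.sq_sqrt (sub_nonneg.2 hDle)]
    have hsum : (Du j + s j * q j) ^ 2 + (Du j - s j * q j) ^ 2 = 2 * DF j := by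
      have hs2 : s j ^ 2 = 1 := by rcases hs j with h | h <;> rw [h] <;> norm_num
      linear_combination 2 * q j ^ 2 * hs2 + 2 * hq2
    constructor <;>
      nlinarith [mul_nonneg hΔx.le (sq_nonneg (Du j + s j * q j)),
        mul_nonneg hΔx.le (sq_nonneg (Du j - s j * q j))]
  intro x
  obtain ⟨j, hlt, hle⟩ : ∃ j : ℤ, 2 * (j : ℝ) * Δx < x ∧ x ≤ (2 * (j : ℝ) + 2) * Δx := by
    have hlt := Int.ceil_lt_add_one (x / (2 * Δx))
    have hle := Int.le_ceil (x / (2 * Δx))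
    have hp : 0 < 2 * Δx := by positivity
    rw [div_le_iff₀ hp] at hle
    rw [← sub_lt_iff_lt_add, lt_div_iff₀ hp] at hlt
    refine ⟨⌈x / (2 * Δx)⌉ - 1, ?_, ?_⟩ <;> push_cast <;> linarith
  rcases le_or_gt x ((2 * (j : ℝ) + 1) * Δx) with hx | hx
  · rw [h1 j x hlt hx, ← sub_sub]
    refine abs_sub_slope_mul_le hΔx (hd _ _ hlt (by linarith)) (hslope j).1 ?_
    rw [abs_le]
    constructor <;> linarith
  · rw [h2 j x hx hle, ← sub_sub]
    refine abs_sub_slope_mul_le hΔx ?_ (hslope j).2 ?_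
    · rcases hle.eq_or_lt with rfl | hlt'
      · have hE0 : 0 ≤ E := hE ▸ integral_nonneg fun z => sq_nonneg _
        simpa using mul_nonneg hΔx.le hE0
      · rw [sub_sq_comm]
        exact hd _ _ hlt' (by linarith)
    · rw [abs_le]
      constructor <;> linarith
end

section
/- With u_Δx defined as in the context (for any choice of signs s_j), one has ‖u − u_Δx‖_{L²(ℝ)} ≤ √2·(1 + √2)·√E·Δx. -/
open MeasureTheory Set

/-- Cauchy–Schwarz on `Ioc a b`. Only `g ^ 2` is assumed measurable; if `g` is not integrable,
the left-hand side is the junk value zero. -/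
theorem sq_setIntegral_Ioc_le {g : ℝ → ℝ} (hg : Integrable (fun z => g z ^ 2) volume)
    {a b : ℝ} (hab : a < b) :
    (∫ z in Ioc a b, g z) ^ 2 ≤ (b - a) * ∫ z in Ioc a b, g z ^ 2 := by
  have hL : 0 < b - a := sub_pos.mpr hab
  by_cases hi : IntegrableOn g (Ioc a b)
  · set I := ∫ z in Ioc a b, g z
    set G := ∫ z in Ioc a b, g z ^ 2
    have hvar : ∀ c : ℝ, 0 ≤ G - 2 * c * I + c ^ 2 * (b - a) := by
      intro c
      have hnonneg : 0 ≤ ∫ z in Ioc a b, (g z - c) ^ 2 := integral_nonneg fun z => sq_nonneg _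
      have hexpand : ∫ z in Ioc a b, (g z - c) ^ 2
          = ∫ z in Ioc a b, (g z ^ 2 - 2 * c * g z + c ^ 2) := by
        congr 1 with z
        ring
      have hconst : IntegrableOn (fun _ : ℝ => c ^ 2) (Ioc a b) := by simp
      have hdiff : IntegrableOn (fun z => g z ^ 2 - 2 * c * g z) (Ioc a b) :=
        hg.integrableOn.sub (hi.const_mul (2 * c))
      rw [hexpand, integral_add hdiff hconst,
        integral_sub hg.integrableOn (hi.const_mul (2 * c)), integral_const_mul] at hnonneg
      simp only [integral_const, MeasurableSet.univ, measureReal_restrict_apply, univ_inter,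
        Real.volume_real_Ioc_of_le hab.le, smul_eq_mul] at hnonneg
      linarith
    have h := mul_nonneg hL.le (hvar (I / (b - a)))
    have heq : (b - a) * (G - 2 * (I / (b - a)) * I + (I / (b - a)) ^ 2 * (b - a))
        = (b - a) * G - I ^ 2 := by
      field_simp
      ring
    linarith
  · rw [integral_undef hi]
    have : 0 ≤ ∫ z in Ioc a b, g z ^ 2 := integral_nonneg fun z => sq_nonneg _
    nlinarith

/-- If on every cell `(n • p, (n + 1) • p]` the integral of `f` is at most `C` times that of `g`,
the same holds on the whole line. -/
theorem lintegral_le_of_forall_Ioc_zsmul {f g : ℝ → ENNReal} {C : ENNReal} {p : ℝ} (hp : 0 < p)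
    (h : ∀ n : ℤ, ∫⁻ x in Ioc (n • p) ((n + 1) • p), f x
      ≤ C * ∫⁻ x in Ioc (n • p) ((n + 1) • p), g x) :
    ∫⁻ x, f x ≤ C * ∫⁻ x, g x := by
  have hsplit : ∀ k : ℝ → ENNReal,
      ∫⁻ x, k x = ∑' n : ℤ, ∫⁻ x in Ioc (n • p) ((n + 1) • p), k x := by
    intro k
    rw [← lintegral_iUnion (fun _ => measurableSet_Ioc) (pairwise_disjoint_Ioc_zsmul p),
      iUnion_Ioc_zsmul hp, Measure.restrict_univ]
  rw [hsplit f, hsplit g, ← ENNReal.tsum_mul_left]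
  exact ENNReal.tsum_le_tsum h

/-- Squared distance between an increment `A` with `A ^ 2 ≤ h * m` and the increment of an affine
piece of slope `d + r`, over a step `t` of length at most `h`. -/
theorem sq_sub_mul_le {A d r t h m D : ℝ} (hh : 0 < h) (hA : A ^ 2 ≤ h * m)
    (ht : t ^ 2 ≤ h ^ 2) (hD : D = m / (2 * h)) (hdr : d ^ 2 + r ^ 2 = D) :
    (A - (d + r) * t) ^ 2 ≤ 4 * h * m := by
  have hslope : (d + r) ^ 2 * h ≤ m := by
    have hm : m = 2 * h * D := by rw [hD]; field_simp
    rw [hm]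
    nlinarith [mul_nonneg hh.le (sq_nonneg (d - r))]
  have hprod : ((d + r) * t) ^ 2 ≤ h * m := by
    calc ((d + r) * t) ^ 2 = (d + r) ^ 2 * t ^ 2 := by ring
      _ ≤ (d + r) ^ 2 * h ^ 2 := by gcongr
      _ = h * ((d + r) ^ 2 * h) := by ring
      _ ≤ h * m := by gcongr
  nlinarith [sq_nonneg (A + (d + r) * t)]

/-- L² projection estimate: `‖u − u_Δx‖_{L²} ≤ √2·(1 + √2)·√E·Δx` for the piecewise
linear projection of `u` (for any choice of signs `s_j`). -/
theorem stmt_5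
    (Δx : ℝ) (hΔx : 0 < Δx)
    (u u' : ℝ → ℝ)
    (hu'int : Integrable (fun z => u' z ^ 2) volume)
    (hftc : ∀ a b : ℝ, a < b → u b - u a = ∫ z in a..b, u' z)
    (E : ℝ) (hE : E = ∫ z, u' z ^ 2)
    (F : ℝ → ℝ) (hF : ∀ x : ℝ, F x = ∫ z in Iio x, u' z ^ 2)
    (Du DF q : ℤ → ℝ)
    (hDu : ∀ j : ℤ, Du j =
      (u ((2 * (j : ℝ) + 2) * Δx) - u ((2 * (j : ℝ)) * Δx)) / (2 * Δx))
    (hDF : ∀ j : ℤ, DF j =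
      (F ((2 * (j : ℝ) + 2) * Δx) - F ((2 * (j : ℝ)) * Δx)) / (2 * Δx))
    (hq : ∀ j : ℤ, q j = Real.sqrt (DF j - Du j ^ 2))
    (s : ℤ → ℝ) (hs : ∀ j : ℤ, s j = 1 ∨ s j = -1)
    (uΔ : ℝ → ℝ)
    (h1 : ∀ j : ℤ, ∀ x : ℝ, (2 * (j : ℝ)) * Δx < x → x ≤ (2 * (j : ℝ) + 1) * Δx →
      uΔ x = u ((2 * (j : ℝ)) * Δx) + (Du j + s j * q j) * (x - (2 * (j : ℝ)) * Δx))
    (h2 : ∀ j : ℤ, ∀ x : ℝ, (2 * (j : ℝ) + 1) * Δx < x → x ≤ (2 * (j : ℝ) + 2) * Δx →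
      uΔ x = u ((2 * (j : ℝ) + 2) * Δx)
        + (Du j - s j * q j) * (x - (2 * (j : ℝ) + 2) * Δx)) :
    eLpNorm (fun x => u x - uΔ x) 2 volume ≤
      ENNReal.ofReal (Real.sqrt 2 * (1 + Real.sqrt 2) * Real.sqrt E * Δx) := by
  have hE0 : 0 ≤ E := hE ▸ integral_nonneg fun z => sq_nonneg _
  have hCS : ∀ a b : ℝ, a ≤ b → (u b - u a) ^ 2 ≤ (b - a) * ∫ z in Ioc a b, u' z ^ 2 := by
    intro a b hab
    rcases hab.eq_or_lt with rfl | hlt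
    · simp
    · rw [hftc a b hlt, intervalIntegral.integral_of_le hab]
      exact sq_setIntegral_Ioc_le hu'int hlt
  have hFsub : ∀ a b : ℝ, a ≤ b → F b - F a = ∫ z in Ioc a b, u' z ^ 2 := by
    intro a b hab
    rw [hF, hF, ← integral_Iic_eq_integral_Iio, ← integral_Iic_eq_integral_Iio,
      intervalIntegral.integral_Iic_sub_Iic hu'int.integrableOn hu'int.integrableOn,
      intervalIntegral.integral_of_le hab]
  have hcell : ∀ j : ℤ, ∀ x ∈ Ioc (2 * (j : ℝ) * Δx) ((2 * (j : ℝ) + 2) * Δx),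
      (u x - uΔ x) ^ 2
        ≤ 4 * Δx * ∫ z in Ioc (2 * (j : ℝ) * Δx) ((2 * (j : ℝ) + 2) * Δx), u' z ^ 2 := by
    intro j x hx
    set a := 2 * (j : ℝ) * Δx with ha
    set b := (2 * (j : ℝ) + 2) * Δx with hb
    have hba : b - a = 2 * Δx := by rw [ha, hb]; ring
    have hmid : (2 * (j : ℝ) + 1) * Δx = a + Δx := by rw [ha]; ring
    have hab : a ≤ b := by linarith
    set m := ∫ z in Ioc a b, u' z ^ 2
    have hm0 : 0 ≤ m := integral_nonneg fun z => sq_nonneg _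
    have hmono : ∀ c d : ℝ, a ≤ c → d ≤ b → ∫ z in Ioc c d, u' z ^ 2 ≤ m := fun c d hc hd =>
      setIntegral_mono_set hu'int.integrableOn (ae_of_all _ fun z => sq_nonneg _)
        (Ioc_subset_Ioc hc hd).eventuallyLE
    have hloc : ∀ c d : ℝ, a ≤ c → c ≤ d → d ≤ b → d - c ≤ Δx →
        (u d - u c) ^ 2 ≤ Δx * m := by
      intro c d hc hcd hd hlen
      calc (u d - u c) ^ 2 ≤ (d - c) * ∫ z in Ioc c d, u' z ^ 2 := hCS c d hcd
        _ ≤ (d - c) * m := mul_le_mul_of_nonneg_left (hmono c d hc hd) (by linarith)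
        _ ≤ Δx * m := mul_le_mul_of_nonneg_right hlen hm0
    have hDFm : DF j = m / (2 * Δx) := by rw [hDF, hFsub a b hab]
    have hDuDF : Du j ^ 2 ≤ DF j := by
      have h := hCS a b hab
      rw [hba] at h
      rw [hDFm, hDu, div_pow, div_le_div_iff₀ (by positivity) (by positivity)]
      nlinarith [mul_le_mul_of_nonneg_right h (by positivity : 0 ≤ 2 * Δx)]
    have hs2 : s j ^ 2 = 1 := by rcases hs j with h | h <;> rw [h] <;> norm_num
    have hsum : Du j ^ 2 + (s j * q j) ^ 2 = DF j := by
      rw [mul_pow, hs2, hq, Real.sq_sqrt (by linarith)]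
      ring
    rcases le_or_gt x (a + Δx) with hxm | hxm
    · have hA : (u x - u a) ^ 2 ≤ Δx * m :=
        hloc a x le_rfl hx.1.le hx.2 (by linarith)
      have ht : (x - a) ^ 2 ≤ Δx ^ 2 := by
        have := hx.1
        apply pow_le_pow_left₀ <;> linarith
      rw [h1 j x hx.1 (hmid ▸ hxm)]
      convert sq_sub_mul_le hΔx hA ht hDFm hsum using 2
      ring
    · have hA : (u x - u b) ^ 2 ≤ Δx * m := by
        rw [← neg_sub, neg_sq]
        exact hloc x b hx.1.le hx.2 le_rfl (by linarith)
      have ht : (x - b) ^ 2 ≤ Δx ^ 2 := by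
        have := hx.2
        rw [← neg_sub, neg_sq]
        apply pow_le_pow_left₀ <;> linarith
      rw [h2 j x (hmid ▸ hxm) hx.2]
      rw [← neg_sq (s j * q j)] at hsum
      convert sq_sub_mul_le hΔx hA ht hDFm hsum using 2
      ring
  have hlint : ∫⁻ x, ‖u x - uΔ x‖ₑ ^ (2 : ℝ) ≤ ENNReal.ofReal (8 * Δx ^ 2 * E) := by
    have henorm : ∀ x, ‖u x - uΔ x‖ₑ ^ (2 : ℝ) = ENNReal.ofReal ((u x - uΔ x) ^ 2) := by
      intro x
      rw [Real.enorm_eq_ofReal_abs, ENNReal.ofReal_rpow_of_nonneg (abs_nonneg _) (by norm_num),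
        Real.rpow_two, sq_abs]
    rw [ENNReal.ofReal_mul (by positivity), hE,
      ofReal_integral_eq_lintegral_ofReal hu'int (ae_of_all _ fun z => sq_nonneg _)]
    refine lintegral_le_of_forall_Ioc_zsmul (p := 2 * Δx) (by positivity) fun j => ?_
    have hl : j • (2 * Δx) = 2 * (j : ℝ) * Δx := by rw [zsmul_eq_mul]; ring
    have hr : (j + 1) • (2 * Δx) = (2 * (j : ℝ) + 2) * Δx := by
      rw [zsmul_eq_mul]; push_cast; ring
    rw [hl, hr, ← ofReal_integral_eq_lintegral_ofReal hu'int.integrableOn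
      (ae_of_all _ fun z => sq_nonneg _), ← ENNReal.ofReal_mul (by positivity)]
    calc ∫⁻ x in Ioc (2 * (j : ℝ) * Δx) ((2 * (j : ℝ) + 2) * Δx), ‖u x - uΔ x‖ₑ ^ (2 : ℝ)
        ≤ ∫⁻ _ in Ioc (2 * (j : ℝ) * Δx) ((2 * (j : ℝ) + 2) * Δx), ENNReal.ofReal
            (4 * Δx * ∫ z in Ioc (2 * (j : ℝ) * Δx) ((2 * (j : ℝ) + 2) * Δx), u' z ^ 2) := by
          refine setLIntegral_mono' measurableSet_Ioc fun x hx => ?_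
          rw [henorm]
          exact ENNReal.ofReal_le_ofReal (hcell j x hx)
      _ = _ := by
          rw [setLIntegral_const, Real.volume_Ioc, ← ENNReal.ofReal_mul
            (mul_nonneg (by positivity) (integral_nonneg fun z => sq_nonneg _))]
          congr 1
          ring
  rw [eLpNorm_eq_lintegral_rpow_enorm_toReal (by norm_num) (by norm_num), ENNReal.toReal_ofNat,
    one_div, ENNReal.rpow_inv_le_iff (by norm_num)]
  refine hlint.trans ?_
  rw [ENNReal.ofReal_rpow_of_nonneg (by positivity) (by norm_num), Real.rpow_two]
  apply ENNReal.ofReal_le_ofReal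
  have hsq2 : Real.sqrt 2 ^ 2 = 2 := Real.sq_sqrt (by norm_num)
  have h1le : 1 ≤ Real.sqrt 2 := Real.one_le_sqrt.mpr (by norm_num)
  have hconst : (2 : ℝ) ^ 2 ≤ (1 + Real.sqrt 2) ^ 2 :=
    pow_le_pow_left₀ (by norm_num) (by linarith) 2
  rw [mul_pow, mul_pow, mul_pow, hsq2, Real.sq_sqrt hE0]
  have := mul_le_mul_of_nonneg_right hconst (by positivity : 0 ≤ 2 * (E * Δx ^ 2))
  linarith
end

section
/- Let Δx > 0, F∞ ≥ 0, and let F, F̂: ℝ → [0, F∞] be nondecreasing functions such that F(2jΔx) = F̂(2jΔx) for every j ∈ ℤ. Then ‖F − F̂‖_{L¹(ℝ)} ≤ 2·F∞·Δx and ‖F − F̂‖_{L²(ℝ)} ≤ 2·F∞·√Δx. -/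
open MeasureTheory Set

/-- The total increase of a monotone `[0, C]`-valued sequence indexed by `ℤ` is at most `C`. -/
lemma tsum_ofReal_increments_le {C : ℝ} {f : ℤ → ℝ} (hf : Monotone f)
    (hrange : ∀ j, f j ∈ Icc 0 C) :
    ∑' j : ℤ, ENNReal.ofReal (f (j + 1) - f j) ≤ ENNReal.ofReal C := by
  have hdisj : Pairwise (Function.onFun Disjoint fun j : ℤ => Ico (f j) (f (j + 1))) :=
    hf.pairwise_disjoint_on_Ico_succ
  calc ∑' j : ℤ, ENNReal.ofReal (f (j + 1) - f j)
      = ∑' j : ℤ, volume (Ico (f j) (f (j + 1))) := by simp only [Real.volume_Ico]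
    _ = volume (⋃ j : ℤ, Ico (f j) (f (j + 1))) :=
        (measure_iUnion hdisj fun _ => measurableSet_Ico).symm
    _ ≤ volume (Icc 0 C) := measure_mono <| iUnion_subset fun j _ hx =>
        ⟨(hrange j).1.trans hx.1, hx.2.le.trans (hrange (j + 1)).2⟩
    _ = ENNReal.ofReal C := by simp [Real.volume_Icc]

/-- Two monotone `[0, C]`-valued functions that agree on the grid `hℤ` have `L¹` distance at
most `C * h`. -/
lemma lintegral_enorm_sub_le_of_monotone {h C : ℝ} (hh : 0 < h) {F G : ℝ → ℝ}
    (hF : Monotone F) (hG : Monotone G) (hrange : ∀ x, F x ∈ Icc 0 C)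
    (hagree : ∀ j : ℤ, F (j * h) = G (j * h)) :
    ∫⁻ x, ‖F x - G x‖ₑ ≤ ENNReal.ofReal C * ENNReal.ofReal h := by
  have hcover : (⋃ j : ℤ, Ico ((j : ℝ) * h) (((j + 1 : ℤ) : ℝ) * h)) = univ := by
    simpa only [zsmul_eq_mul] using iUnion_Ico_zsmul hh
  have hmono : Monotone fun j : ℤ => F (j * h) := fun i j hij => hF <| by gcongr
  rw [← setLIntegral_univ, ← hcover]
  calc ∫⁻ x in ⋃ j : ℤ, Ico ((j : ℝ) * h) (((j + 1 : ℤ) : ℝ) * h), ‖F x - G x‖ₑ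
      ≤ ∑' j : ℤ, ∫⁻ x in Ico ((j : ℝ) * h) (((j + 1 : ℤ) : ℝ) * h), ‖F x - G x‖ₑ :=
        lintegral_iUnion_le _ _
    _ ≤ ∑' j : ℤ, ENNReal.ofReal (F (((j + 1 : ℤ) : ℝ) * h) - F (j * h)) *
          ENNReal.ofReal h := by
        refine ENNReal.tsum_le_tsum fun j => ?_
        have hvol : volume (Ico ((j : ℝ) * h) (((j + 1 : ℤ) : ℝ) * h)) = ENNReal.ofReal h := by
          rw [Real.volume_Ico]
          push_cast
          ring_nf
        rw [← hvol, ← setLIntegral_const]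
        refine setLIntegral_mono measurable_const fun x hx => ?_
        rw [Real.enorm_eq_ofReal_abs]
        refine ENNReal.ofReal_le_ofReal (abs_le.2 ?_)
        have hF₁ := hF hx.1
        have hF₂ := hF hx.2.le
        have hG₁ := hG hx.1
        have hG₂ := hG hx.2.le
        rw [← hagree] at hG₁ hG₂
        constructor <;> linarith
    _ ≤ ENNReal.ofReal C * ENNReal.ofReal h := by
        rw [ENNReal.tsum_mul_right]
        gcongr
        exact tsum_ofReal_increments_le hmono fun j => hrange _

/-- If two nondecreasing functions with values in `[0, F∞]` agree at every even grid
point `2jΔx`, then `‖F − F̂‖_{L¹} ≤ 2·F∞·Δx` and `‖F − F̂‖_{L²} ≤ 2·F∞·√Δx`. -/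
theorem stmt_6 (Δx Finf : ℝ) (hΔx : 0 < Δx) (hFinf : 0 ≤ Finf)
    (F Fh : ℝ → ℝ) (hFmono : Monotone F) (hFhmono : Monotone Fh)
    (hFrange : ∀ x : ℝ, F x ∈ Icc 0 Finf) (hFhrange : ∀ x : ℝ, Fh x ∈ Icc 0 Finf)
    (hagree : ∀ j : ℤ, F (2 * (j : ℝ) * Δx) = Fh (2 * (j : ℝ) * Δx)) :
    eLpNorm (fun x => F x - Fh x) 1 volume ≤ ENNReal.ofReal (2 * Finf * Δx) ∧
    eLpNorm (fun x => F x - Fh x) 2 volume ≤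
      ENNReal.ofReal (2 * Finf * Real.sqrt Δx) := by
  have hL1 : ∫⁻ x, ‖F x - Fh x‖ₑ ≤ ENNReal.ofReal (2 * Finf * Δx) := by
    have hgrid : ∀ j : ℤ, F (j * (2 * Δx)) = Fh (j * (2 * Δx)) := fun j => by
      rw [show (j : ℝ) * (2 * Δx) = 2 * j * Δx by ring, hagree]
    refine (lintegral_enorm_sub_le_of_monotone (by positivity) hFmono hFhmono hFrange
      hgrid).trans_eq ?_
    rw [← ENNReal.ofReal_mul hFinf]
    ring_nf
  refine ⟨by rwa [eLpNorm_one_eq_lintegral_enorm], ?_⟩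
  have hbound : ∀ x, ‖F x - Fh x‖ₑ ≤ ENNReal.ofReal Finf := fun x => by
    rw [Real.enorm_eq_ofReal_abs]
    refine ENNReal.ofReal_le_ofReal (abs_le.2 ?_)
    obtain ⟨h₁, h₂⟩ := hFrange x
    obtain ⟨h₃, h₄⟩ := hFhrange x
    constructor <;> linarith
  have hL2 : eLpNorm (fun x => F x - Fh x) 2 volume ^ 2 ≤
      ENNReal.ofReal (2 * Finf * Real.sqrt Δx) ^ 2 := by
    calc eLpNorm (fun x => F x - Fh x) 2 volume ^ 2
        = ∫⁻ x, ‖F x - Fh x‖ₑ ^ 2 := by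
          simpa using eLpNorm_nnreal_pow_eq_lintegral (μ := volume)
            (f := fun x => F x - Fh x) (p := 2) two_ne_zero
      _ ≤ ∫⁻ x, ENNReal.ofReal Finf * ‖F x - Fh x‖ₑ := by
          refine lintegral_mono fun x => ?_
          rw [pow_two]
          gcongr
          exact hbound x
      _ = ENNReal.ofReal Finf * ∫⁻ x, ‖F x - Fh x‖ₑ :=
          lintegral_const_mul' _ _ ENNReal.ofReal_ne_top
      _ ≤ ENNReal.ofReal Finf * ENNReal.ofReal (2 * Finf * Δx) := by gcongr
      _ ≤ ENNReal.ofReal (2 * Finf * Real.sqrt Δx) ^ 2 := by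
          rw [← ENNReal.ofReal_mul hFinf, ← ENNReal.ofReal_pow (by positivity)]
          refine ENNReal.ofReal_le_ofReal ?_
          rw [mul_pow, Real.sq_sqrt hΔx.le]
          nlinarith [mul_nonneg (sq_nonneg Finf) hΔx.le]
  exact (ENNReal.pow_le_pow_left_iff two_ne_zero).1 hL2
end

section
/- Let Δx > 0, G∞ ≥ 0, and let G, Ĝ: ℝ → [0, G∞] be nondecreasing functions with G(2jΔx) = Ĝ(2jΔx) for every j ∈ ℤ. Define y(ξ) = sup{x ∈ ℝ : x + G(x) < ξ} and ŷ(ξ) = sup{x ∈ ℝ : x + Ĝ(x) < ξ} for ξ ∈ ℝ. Then |y(ξ) − ŷ(ξ)| ≤ 2Δx for every ξ ∈ ℝ. -/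
open Set

/-- If two functions, the first one nondecreasing and bounded above and the second one nonnegative,
agree on the grid `hℤ`, then the generalized inverse of `x ↦ x + F x` exceeds that of
`x ↦ x + H x` by at most `h`. -/
theorem sSup_add_lt_le_of_eq_on_grid {h C : ℝ} (hh : 0 < h) {F H : ℝ → ℝ} (hF : Monotone F)
    (hFC : ∀ x, F x ≤ C) (hH : ∀ x, 0 ≤ H x) (hFH : ∀ j : ℤ, F (j * h) = H (j * h)) (ξ : ℝ) :
    sSup {x : ℝ | x + F x < ξ} ≤ sSup {x : ℝ | x + H x < ξ} + h := by
  have hbdd : BddAbove {x : ℝ | x + H x < ξ} := by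
    refine ⟨ξ, fun x hx => ?_⟩
    have hx' : x + H x < ξ := hx
    linarith [hH x]
  have hne : {x : ℝ | x + F x < ξ}.Nonempty := by
    refine ⟨ξ - C - 1, ?_⟩
    rw [mem_ofPred_eq]
    linarith [hFC (ξ - C - 1)]
  refine csSup_le hne fun x hx => ?_
  have hx' : x + F x < ξ := hx
  have hle : (⌊x / h⌋ : ℝ) * h ≤ x := (le_div_iff₀ hh).1 (Int.floor_le _)
  have hlt : x < ((⌊x / h⌋ : ℝ) + 1) * h := (div_lt_iff₀ hh).1 (Int.lt_floor_add_one _)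
  have hmem : (⌊x / h⌋ : ℝ) * h ∈ {x : ℝ | x + H x < ξ} := by
    rw [mem_ofPred_eq, ← hFH]
    linarith [hF hle]
  linarith [le_csSup hbdd hmem]

/-- If two nondecreasing functions `G, Ĝ : ℝ → [0, G∞]` agree at every even grid point
`2jΔx`, then their generalized inverses `y(ξ) = sup{x : x + G(x) < ξ}` and
`ŷ(ξ) = sup{x : x + Ĝ(x) < ξ}` satisfy `|y(ξ) − ŷ(ξ)| ≤ 2Δx` for every `ξ`. -/
theorem stmt_7 (Δx Ginf : ℝ) (hΔx : 0 < Δx) (hGinf : 0 ≤ Ginf)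
    (G Gh : ℝ → ℝ) (hGmono : Monotone G) (hGhmono : Monotone Gh)
    (hGrange : ∀ x : ℝ, G x ∈ Icc 0 Ginf) (hGhrange : ∀ x : ℝ, Gh x ∈ Icc 0 Ginf)
    (hagree : ∀ j : ℤ, G (2 * (j : ℝ) * Δx) = Gh (2 * (j : ℝ) * Δx))
    (y yh : ℝ → ℝ)
    (hy : ∀ ξ : ℝ, y ξ = sSup {x : ℝ | x + G x < ξ})
    (hyh : ∀ ξ : ℝ, yh ξ = sSup {x : ℝ | x + Gh x < ξ}) :
    ∀ ξ : ℝ, |y ξ - yh ξ| ≤ 2 * Δx := by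
  intro ξ
  have hgrid : ∀ j : ℤ, G (j * (2 * Δx)) = Gh (j * (2 * Δx)) := fun j => by
    have hj : (j : ℝ) * (2 * Δx) = 2 * j * Δx := by ring
    rw [hj, hagree]
  have h2 : 0 < 2 * Δx := by positivity
  have h₁ := sSup_add_lt_le_of_eq_on_grid h2 hGmono (fun x => (hGrange x).2)
    (fun x => (hGhrange x).1) hgrid ξ
  have h₂ := sSup_add_lt_le_of_eq_on_grid h2 hGhmono (fun x => (hGhrange x).2)
    (fun x => (hGrange x).1) (fun j => (hgrid j).symm) ξ
  rw [hy, hyh, abs_le]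
  constructor <;> linarith
end

section
/- Let E ≥ 0 and Δx > 0. Let u: ℝ → ℝ satisfy u(b) − u(a) = ∫_a^b u′(z) dz for all a < b with ∫_ℝ u′(z)² dz ≤ E, let û: ℝ → ℝ satisfy sup over x of |u(x) − û(x)| ≤ (1 + √2)·√E·√Δx, and let y, ŷ: ℝ → ℝ satisfy sup over ξ of |y(ξ) − ŷ(ξ)| ≤ 2Δx. Then sup over ξ ∈ ℝ of |u(y(ξ)) − û(ŷ(ξ))| ≤ (1 + 2√2)·√E·√Δx. -/
open MeasureTheory

/-- Cauchy–Schwarz inequality for the interval integral of a function against `1`. -/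
theorem sq_intervalIntegral_le_mul_intervalIntegral_sq {f : ℝ → ℝ} {a b : ℝ} (hab : a < b)
    (hf2 : IntervalIntegrable (fun z => f z ^ 2) volume a b) :
    (∫ z in a..b, f z) ^ 2 ≤ (b - a) * ∫ z in a..b, f z ^ 2 := by
  have hL : 0 < b - a := sub_pos.2 hab
  by_cases hf : IntervalIntegrable f volume a b
  · set m := ∫ z in a..b, f z with hm
    have hnonneg : 0 ≤ ∫ z in a..b, ((b - a) * f z - m) ^ 2 :=
      intervalIntegral.integral_nonneg hab.le fun z _ => sq_nonneg _
    have hexpand : ∫ z in a..b, ((b - a) * f z - m) ^ 2 =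
        (b - a) ^ 2 * (∫ z in a..b, f z ^ 2) - 2 * (b - a) * m * m + (b - a) * m ^ 2 := by
      have hfun : (fun z => ((b - a) * f z - m) ^ 2) =
          fun z => (b - a) ^ 2 * f z ^ 2 - 2 * (b - a) * m * f z + m ^ 2 := by
        funext z
        ring
      rw [hfun, intervalIntegral.integral_add ((hf2.const_mul _).sub (hf.const_mul _))
        intervalIntegrable_const, intervalIntegral.integral_sub (hf2.const_mul _)
        (hf.const_mul _), intervalIntegral.integral_const_mul,
        intervalIntegral.integral_const_mul, intervalIntegral.integral_const, ← hm, smul_eq_mul]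
    rw [hexpand] at hnonneg
    refine le_of_mul_le_mul_left ?_ hL
    linarith
  · rw [intervalIntegral.integral_undef hf, zero_pow two_ne_zero]
    exact mul_nonneg hL.le
      (intervalIntegral.integral_nonneg hab.le fun z _ => sq_nonneg _)

/-- A function whose derivative is square integrable is `1/2`-Hölder continuous. -/
theorem abs_sub_le_sqrt_mul_sqrt_of_integral_sq_le {E : ℝ} {u u' : ℝ → ℝ}
    (hu'int : Integrable (fun z => u' z ^ 2) volume)
    (hftc : ∀ a b : ℝ, a < b → u b - u a = ∫ z in a..b, u' z)
    (hE' : (∫ z, u' z ^ 2) ≤ E) (a b : ℝ) :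
    |u a - u b| ≤ √E * √|a - b| := by
  wlog hab : b < a generalizing a b
  · rcases (not_lt.1 hab).eq_or_lt with rfl | h
    · simp
    · rw [abs_sub_comm, abs_sub_comm a]
      exact this b a h
  have hle : ∫ z in b..a, u' z ^ 2 ≤ E := by
    rw [intervalIntegral.integral_of_le hab.le]
    exact (setIntegral_le_integral hu'int (.of_forall fun z => sq_nonneg _)).trans hE'
  rw [abs_of_pos (sub_pos.2 hab), mul_comm, ← Real.sqrt_mul (sub_pos.2 hab).le, hftc b a hab]
  exact Real.abs_le_sqrt
    ((sq_intervalIntegral_le_mul_intervalIntegral_sq hab hu'int.intervalIntegrable).trans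
      (mul_le_mul_of_nonneg_left hle (sub_pos.2 hab).le))

/-- Composition estimate: if `u` is absolutely continuous with `∫ u′² ≤ E`,
`‖u − û‖_∞ ≤ (1 + √2)√E·√Δx` and `‖y − ŷ‖_∞ ≤ 2Δx`, then
`‖u ∘ y − û ∘ ŷ‖_∞ ≤ (1 + 2√2)√E·√Δx`. -/
theorem stmt_8 (E Δx : ℝ) (hE : 0 ≤ E) (hΔx : 0 < Δx)
    (u u' uh : ℝ → ℝ)
    (hu'int : Integrable (fun z => u' z ^ 2) volume)
    (hftc : ∀ a b : ℝ, a < b → u b - u a = ∫ z in a..b, u' z)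
    (hE' : (∫ z, u' z ^ 2) ≤ E)
    (hclose : ∀ x : ℝ, |u x - uh x| ≤ (1 + Real.sqrt 2) * Real.sqrt E * Real.sqrt Δx)
    (y yh : ℝ → ℝ)
    (hy : ∀ ξ : ℝ, |y ξ - yh ξ| ≤ 2 * Δx) :
    ∀ ξ : ℝ, |u (y ξ) - uh (yh ξ)| ≤
      (1 + 2 * Real.sqrt 2) * Real.sqrt E * Real.sqrt Δx := by
  intro ξ
  have hholder : |u (y ξ) - u (yh ξ)| ≤ √E * (√2 * √Δx) := by
    rw [← Real.sqrt_mul zero_le_two]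
    exact (abs_sub_le_sqrt_mul_sqrt_of_integral_sq_le hu'int hftc hE' _ _).trans
      (mul_le_mul_of_nonneg_left (Real.sqrt_le_sqrt (hy ξ)) (Real.sqrt_nonneg E))
  linarith [abs_sub_le (u (y ξ)) (u (yh ξ)) (uh (yh ξ)), hclose (yh ξ)]
end
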